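/- arXiv:2405.15990 — 2 statements merged into one kernel-verified Lean document; each statement's English description precedes it below -/
import Mathlib

section
/- Let X, F, J, δ, L and the VIJI iterates (x_k, v_k, s_k, λ_k) with η = 10 be as in the context, and assume additionally that F is μ-strongly monotone on X (⟨F(x) − F(y), x − y⟩ ≥ μ∥x − y∥² with μ > 0) and that x* ∈ X is a strong solution (⟨F(x*), x − x*⟩ ≥ 0 for all x ∈ X). Then for every integer T ≥ 1 and x̃_T = (∑_{k=1}^T λ_k x_k)/(∑_{k=1}^T λ_k): μ ∥x̃_T − x*∥² ≤ (1/2)∥x_0 − x*∥² · ( 2048 L² ∥x_0 − x*∥² / T³ + 2048 δ² / T² )^{1/2}. -/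
open scoped RealInnerProductSpace

section Helpers

variable {E : Type*} [NormedAddCommGroup E] [InnerProductSpace ℝ E]

/-- First-order Taylor bound on a convex set for a map with Lipschitz derivative there. -/
lemma norm_taylor_le_of_fderiv_lipschitz {X : Set E} (hX : Convex ℝ X) {F : E → E}
    {F' : E → E →L[ℝ] E} (hF' : ∀ x, HasFDerivAt F (F' x) x) {L : ℝ}
    (hL : ∀ x ∈ X, ∀ y ∈ X, ‖F' x - F' y‖ ≤ L * ‖x - y‖) {v x : E} (hv : v ∈ X) (hx : x ∈ X) :
    ‖F x - F v - F' v (x - v)‖ ≤ L / 2 * ‖x - v‖ ^ 2 := by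
  set p := x - v with hp
  have hline : ∀ t : ℝ, HasDerivAt (fun t : ℝ => v + t • p) p t := fun t => by
    simpa using ((hasDerivAt_id t).smul_const p).const_add v
  have hf : ∀ t : ℝ, HasDerivAt (fun t : ℝ => F (v + t • p) - F v - t • F' v p)
      (F' (v + t • p) p - F' v p) t := fun t => by
    have h1 := (hF' (v + t • p)).comp_hasDerivAt t (hline t)
    have h2 : HasDerivAt (fun t : ℝ => t • F' v p) (F' v p) t := by
      simpa using (hasDerivAt_id t).smul_const (F' v p)
    exact (h1.sub_const (F v)).sub h2
  have hB : ∀ t : ℝ, HasDerivAt (fun t : ℝ => L / 2 * ‖p‖ ^ 2 * t ^ 2) (L * ‖p‖ ^ 2 * t) t :=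
    fun t => ((hasDerivAt_pow 2 t).const_mul (L / 2 * ‖p‖ ^ 2)).congr_deriv (by push_cast; ring)
  have key := image_norm_le_of_norm_deriv_right_le_deriv_boundary (a := (0 : ℝ)) (b := 1)
    (fun t _ => (hf t).continuousAt.continuousWithinAt) (fun t _ => (hf t).hasDerivWithinAt)
    (by simp) hB (fun t ht => by
      have hmem : v + t • p ∈ X := hX.add_smul_sub_mem hv hx ⟨ht.1, ht.2.le⟩
      have h1 := hL _ hmem _ hv
      rw [add_sub_cancel_left, norm_smul, Real.norm_of_nonneg ht.1] at h1
      calc ‖F' (v + t • p) p - F' v p‖ ≤ ‖F' (v + t • p) - F' v‖ * ‖p‖ :=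
            (F' (v + t • p) - F' v).le_opNorm p
        _ ≤ L * (t * ‖p‖) * ‖p‖ := by gcongr
        _ = L * ‖p‖ ^ 2 * t := by ring)
    (Set.right_mem_Icc.2 zero_le_one)
  simpa [hp] using key

/-- Quadratic growth at the maximizer of `w ↦ ⟪s, w - c⟫ - ‖w - c‖² / 2` over a convex set. -/
lemma quadratic_growth_of_isMax {X : Set E} (hX : Convex ℝ X) {s c v : E} (hv : v ∈ X)
    (hmax : ∀ w ∈ X, ⟪s, w - c⟫ - 1 / 2 * ‖w - c‖ ^ 2 ≤ ⟪s, v - c⟫ - 1 / 2 * ‖v - c‖ ^ 2)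
    {w : E} (hw : w ∈ X) :
    ⟪s, w - c⟫ - 1 / 2 * ‖w - c‖ ^ 2 + 1 / 2 * ‖w - v‖ ^ 2 ≤
      ⟪s, v - c⟫ - 1 / 2 * ‖v - c‖ ^ 2 := by
  have expand : ∀ t : ℝ, ⟪s, v + t • (w - v) - c⟫ - 1 / 2 * ‖v + t • (w - v) - c‖ ^ 2 =
      ⟪s, v - c⟫ - 1 / 2 * ‖v - c‖ ^ 2 + t * (⟪s, w - v⟫ - ⟪v - c, w - v⟫)
        - t ^ 2 / 2 * ‖w - v‖ ^ 2 := fun t => by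
    rw [add_sub_right_comm, inner_add_right, norm_add_sq_real, inner_smul_right, inner_smul_right,
      norm_smul, mul_pow, Real.norm_eq_abs, sq_abs]
    ring
  have hfirst : ⟪s, w - v⟫ - ⟪v - c, w - v⟫ ≤ 0 := by
    by_contra! hpos
    set g := ⟪s, w - v⟫ - ⟪v - c, w - v⟫
    set n := ‖w - v‖ ^ 2
    have hn : 0 ≤ n := sq_nonneg _
    have hd : 0 < g + n := by linarith
    have hmem : v + (g / (g + n)) • (w - v) ∈ X :=
      hX.add_smul_sub_mem hv hw ⟨by positivity, (div_le_one hd).2 (by linarith)⟩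
    have h := hmax _ hmem
    rw [expand] at h
    have ht : 0 < g / (g + n) := by positivity
    have h2 : (g / (g + n)) * (g - g / (g + n) / 2 * n) ≤ 0 := by linarith
    have h3 : g / (g + n) * n ≤ g := by
      rw [div_mul_eq_mul_div, div_le_iff₀ hd]; nlinarith
    nlinarith
  have h1 := expand 1
  rw [one_smul, add_sub_cancel v w] at h1
  linarith

/-- One extragradient-type step: the inexact second-order model controls `F` at the new point. -/
lemma inner_step_le {F₁ Ω₁ e p q : E} {a lam : ℝ} (hlam : 0 < lam)
    (hF₁ : F₁ = Ω₁ + e - (10 * a) • p) (hΩ₁ : ⟪Ω₁, p - q⟫ ≤ a * ‖p‖ ^ 2)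
    (he : ‖e‖ ≤ a * ‖p‖) (hlo : 1 / 32 ≤ lam * a) (hhi : lam * a ≤ 1 / 22) :
    lam * ⟪F₁, p - q⟫ ≤ 1 / 2 * ‖q‖ ^ 2 - 1 / 8 * ‖p‖ ^ 2 := by
  have ha : 0 < a := pos_of_mul_pos_right (by linarith : 0 < lam * a) hlam.le
  have h1 : ⟪e, p - q⟫ ≤ a * ‖p‖ * (‖p‖ + ‖q‖) :=
    (real_inner_le_norm _ _).trans (by gcongr; exact norm_sub_le _ _)
  have h2 : ⟪p, q⟫ ≤ ‖p‖ * ‖q‖ := real_inner_le_norm _ _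
  have h3 : ⟪F₁, p - q⟫ ≤ a * (11 * (‖p‖ * ‖q‖) - 8 * ‖p‖ ^ 2) := by
    have h4 : ⟪p, p - q⟫ = ‖p‖ ^ 2 - ⟪p, q⟫ := by rw [inner_sub_right, real_inner_self_eq_norm_sq]
    rw [hF₁, inner_sub_left, inner_add_left, real_inner_smul_left, h4]
    nlinarith
  have h5 := mul_le_mul_of_nonneg_left h3 hlam.le
  rw [← mul_assoc] at h5
  set c := lam * a
  nlinarith [sq_nonneg (‖q‖ - 11 * c * ‖p‖),
    mul_nonneg (sq_nonneg ‖p‖) (mul_nonneg (sub_nonneg.2 hlo) (sub_nonneg.2 hhi)),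
    mul_nonneg (sq_nonneg ‖p‖) (sub_nonneg.2 hlo)]

/-- Jensen's inequality for the squared distance to a point and an unnormalized average. -/
lemma sum_mul_norm_average_sub_sq_le {ι : Type*} (S : Finset ι) {w : ι → ℝ} (x : ι → E) (z : E)
    (hw : ∀ i ∈ S, 0 ≤ w i) (hW : 0 < ∑ i ∈ S, w i) :
    (∑ i ∈ S, w i) * ‖(∑ i ∈ S, w i)⁻¹ • ∑ i ∈ S, w i • x i - z‖ ^ 2 ≤
      ∑ i ∈ S, w i * ‖x i - z‖ ^ 2 := by
  set W := ∑ i ∈ S, w i with hWdef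
  have h1 : W⁻¹ • ∑ i ∈ S, w i • x i - z = W⁻¹ • ∑ i ∈ S, w i • (x i - z) := by
    simp only [smul_sub, Finset.sum_sub_distrib, ← Finset.sum_smul]
    rw [← hWdef, inv_smul_smul₀ hW.ne']
  have h2 : ‖∑ i ∈ S, w i • (x i - z)‖ ≤ ∑ i ∈ S, w i * ‖x i - z‖ :=
    (norm_sum_le _ _).trans_eq (Finset.sum_congr rfl fun i hi => by
      rw [norm_smul, Real.norm_of_nonneg (hw i hi)])
  have h3 : (∑ i ∈ S, w i * ‖x i - z‖) ^ 2 ≤ W * ∑ i ∈ S, w i * ‖x i - z‖ ^ 2 :=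
    Finset.sum_sq_le_sum_mul_sum_of_sq_le_mul S hw
      (fun i hi => mul_nonneg (hw i hi) (sq_nonneg _)) (fun i _ => (by ring : _ = _).le)
  have h4 : ‖∑ i ∈ S, w i • (x i - z)‖ ^ 2 ≤ W * ∑ i ∈ S, w i * ‖x i - z‖ ^ 2 :=
    (pow_le_pow_left₀ (norm_nonneg _) h2 2).trans h3
  rw [h1, norm_smul, norm_inv, Real.norm_of_nonneg hW.le]
  calc W * (W⁻¹ * ‖∑ i ∈ S, w i • (x i - z)‖) ^ 2
      = W⁻¹ * ‖∑ i ∈ S, w i • (x i - z)‖ ^ 2 := by field_simp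
    _ ≤ W⁻¹ * (W * ∑ i ∈ S, w i * ‖x i - z‖ ^ 2) := by gcongr
    _ = ∑ i ∈ S, w i * ‖x i - z‖ ^ 2 := by rw [inv_mul_cancel_left₀ hW.ne']

/-- Lower bound on a sum of step sizes `w i` coupled to `L / 2 * r i + δ`, in terms of a bound on
the sum of the squares of `r i`. -/
lemma inv_sum_le_sqrt {ι : Type*} {S : Finset ι} {w r : ι → ℝ} {L δ D T : ℝ}
    (hT : (S.card : ℝ) = T) (hTpos : 0 < T) (hw : ∀ i ∈ S, 0 < w i)
    (hlo : ∀ i ∈ S, 1 / 32 ≤ w i * (L / 2 * r i + δ)) (hr : ∑ i ∈ S, r i ^ 2 ≤ 4 * D ^ 2) :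
    (∑ i ∈ S, w i)⁻¹ ≤ √(2048 * L ^ 2 * D ^ 2 / T ^ 3 + 2048 * δ ^ 2 / T ^ 2) := by
  set a : ι → ℝ := fun i => L / 2 * r i + δ
  have ha : ∀ i ∈ S, 0 < a i := fun i hi =>
    pos_of_mul_pos_right (lt_of_lt_of_le (by norm_num) (hlo i hi)) (hw i hi).le
  have hne : S.Nonempty := by
    rw [← Finset.card_pos]
    exact_mod_cast hT ▸ hTpos
  have hW : 0 < ∑ i ∈ S, w i := Finset.sum_pos hw hne
  have h1 : T ^ 2 ≤ 32 * (∑ i ∈ S, w i) * ∑ i ∈ S, a i := by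
    have := Finset.sum_sq_le_sum_mul_sum_of_sq_le_mul S (r := fun _ => (1 : ℝ))
      (f := fun i => 32 * w i) (g := a) (fun i hi => by have := hw i hi; positivity)
      (fun i hi => (ha i hi).le) (fun i hi => by have := hlo i hi; simp only [a]; linarith)
    simpa [hT, ← Finset.mul_sum] using this
  have h2 : (∑ i ∈ S, a i) ^ 2 ≤ T * ∑ i ∈ S, a i ^ 2 := hT ▸ sq_sum_le_card_mul_sum_sq
  have h3 : ∑ i ∈ S, a i ^ 2 ≤ 2 * L ^ 2 * D ^ 2 + 2 * T * δ ^ 2 := by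
    calc ∑ i ∈ S, a i ^ 2 ≤ ∑ i ∈ S, (L ^ 2 / 2 * r i ^ 2 + 2 * δ ^ 2) :=
          Finset.sum_le_sum fun i _ => by
            simp only [a]; nlinarith [sq_nonneg (L / 2 * r i - δ)]
      _ = L ^ 2 / 2 * ∑ i ∈ S, r i ^ 2 + 2 * T * δ ^ 2 := by
          rw [Finset.sum_add_distrib, ← Finset.mul_sum, Finset.sum_const, nsmul_eq_mul, hT]; ring
      _ ≤ L ^ 2 / 2 * (4 * D ^ 2) + 2 * T * δ ^ 2 := by gcongr
      _ = _ := by ring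
  have h4 : (∑ i ∈ S, w i)⁻¹ ≤ 32 * (∑ i ∈ S, a i) / T ^ 2 := by
    rw [inv_eq_one_div, div_le_div_iff₀ hW (by positivity)]
    linarith
  refine h4.trans (Real.le_sqrt_of_sq_le ?_)
  calc (32 * (∑ i ∈ S, a i) / T ^ 2) ^ 2 = 1024 / T ^ 4 * (∑ i ∈ S, a i) ^ 2 := by
        rw [div_pow, mul_pow]; ring
    _ ≤ 1024 / T ^ 4 * (T * (2 * L ^ 2 * D ^ 2 + 2 * T * δ ^ 2)) := by
        gcongr
        exact h2.trans (by gcongr)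
    _ = _ := by field_simp; ring

end Helpers

/-- key inequality in the strongly monotone analysis: if `F` is in addition
`μ`-strongly monotone on `X` and `x*` is a strong solution, then for the weighted average
`x̃_T`, `μ‖x̃_T − x*‖² ≤ (1/2)‖x_0 − x*‖² (2048 L²‖x_0 − x*‖²/T³ + 2048 δ²/T²)^{1/2}`. -/
theorem viji_strongly_monotone_key_inequality
    (d : ℕ) (X : Set (EuclideanSpace ℝ (Fin d)))
    (hXconv : Convex ℝ X) (hXclosed : IsClosed X) (hXbdd : Bornology.IsBounded X)
    (F : EuclideanSpace ℝ (Fin d) → EuclideanSpace ℝ (Fin d))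
    (F' : EuclideanSpace ℝ (Fin d) → EuclideanSpace ℝ (Fin d) →L[ℝ] EuclideanSpace ℝ (Fin d))
    (hF' : ∀ x, HasFDerivAt F (F' x) x)
    (L δ : ℝ)
    (hsmooth : ∀ x ∈ X, ∀ y ∈ X, ‖F' x - F' y‖ ≤ L * ‖x - y‖)
    (J : EuclideanSpace ℝ (Fin d) → EuclideanSpace ℝ (Fin d) →L[ℝ] EuclideanSpace ℝ (Fin d))
    (hJ : ∀ v ∈ X, ‖F' v - J v‖ ≤ δ)
    (Ω : EuclideanSpace ℝ (Fin d) → EuclideanSpace ℝ (Fin d) → EuclideanSpace ℝ (Fin d))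
    (hΩ : ∀ v x, Ω v x = F v + J v (x - v) + (10 * δ) • (x - v)
      + (5 * L * ‖x - v‖) • (x - v))
    (xs vs s : ℕ → EuclideanSpace ℝ (Fin d)) (lam : ℕ → ℝ)
    (hxsX : ∀ k, xs k ∈ X) (hvsX : ∀ k, vs k ∈ X)
    (hs0 : s 0 = 0)
    (hlampos : ∀ k, 0 < lam k)
    (hvmax : ∀ k, ∀ w ∈ X,
      ⟪s k, w - xs 0⟫ - 1 / 2 * ‖w - xs 0‖ ^ 2 ≤
        ⟪s k, vs (k + 1) - xs 0⟫ - 1 / 2 * ‖vs (k + 1) - xs 0‖ ^ 2)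
    (hsub : ∀ k, ∀ w ∈ X,
      ⟪Ω (vs (k + 1)) (xs (k + 1)), xs (k + 1) - w⟫ ≤
        L / 2 * ‖xs (k + 1) - vs (k + 1)‖ ^ 3 + δ * ‖xs (k + 1) - vs (k + 1)‖ ^ 2)
    (hlam : ∀ k, 1 / 32 ≤ lam (k + 1) * (L / 2 * ‖xs (k + 1) - vs (k + 1)‖ + δ) ∧
      lam (k + 1) * (L / 2 * ‖xs (k + 1) - vs (k + 1)‖ + δ) ≤ 1 / 22)
    (hsrec : ∀ k, s (k + 1) = s k - lam (k + 1) • F (xs (k + 1)))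
    (μ : ℝ) (hμ : 0 < μ)
    (hstrong : ∀ x ∈ X, ∀ y ∈ X, μ * ‖x - y‖ ^ 2 ≤ ⟪F x - F y, x - y⟫)
    (xstar : EuclideanSpace ℝ (Fin d)) (hxstarX : xstar ∈ X)
    (hstrongsol : ∀ x ∈ X, 0 ≤ ⟪F xstar, x - xstar⟫) :
    ∀ T : ℕ, 1 ≤ T →
      μ * ‖((∑ k ∈ Finset.Icc 1 T, lam k)⁻¹ •
          ∑ k ∈ Finset.Icc 1 T, lam k • xs k) - xstar‖ ^ 2 ≤
        1 / 2 * ‖xs 0 - xstar‖ ^ 2 *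
          Real.sqrt (2048 * L ^ 2 * ‖xs 0 - xstar‖ ^ 2 / (T : ℝ) ^ 3
            + 2048 * δ ^ 2 / (T : ℝ) ^ 2) := by
  have hstep : ∀ k, lam (k + 1) * ⟪F (xs (k + 1)), xs (k + 1) - vs (k + 2)⟫ ≤
      1 / 2 * ‖vs (k + 2) - vs (k + 1)‖ ^ 2 - 1 / 8 * ‖xs (k + 1) - vs (k + 1)‖ ^ 2 := fun k => by
    have hpq : xs (k + 1) - vs (k + 2) =
        (xs (k + 1) - vs (k + 1)) - (vs (k + 2) - vs (k + 1)) := by abel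
    have hx := hxsX (k + 1)
    have hv := hvsX (k + 1)
    have hΩk := hsub k _ (hvsX (k + 2))
    rw [hpq] at hΩk ⊢
    refine inner_step_le
      (e := (F (xs (k + 1)) - F (vs (k + 1)) - F' (vs (k + 1)) (xs (k + 1) - vs (k + 1))) +
        (F' (vs (k + 1)) - J (vs (k + 1))) (xs (k + 1) - vs (k + 1)))
      (a := L / 2 * ‖xs (k + 1) - vs (k + 1)‖ + δ) (hlampos _) ?_ (hΩk.trans_eq (by ring)) ?_
      (hlam k).1 (hlam k).2
    · rw [hΩ, sub_apply]
      module
    · calc _ ≤ L / 2 * ‖xs (k + 1) - vs (k + 1)‖ ^ 2 + δ * ‖xs (k + 1) - vs (k + 1)‖ :=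
            norm_add_le_of_le (norm_taylor_le_of_fderiv_lipschitz hXconv hF' hsmooth hv hx)
              (ContinuousLinearMap.le_of_opNorm_le _ (hJ _ hv) _)
        _ = _ := by ring
  have hlyap : ∀ T : ℕ, ∑ k ∈ Finset.Icc 1 T, lam k * ⟪F (xs k), xs k - xstar⟫ +
      1 / 8 * ∑ k ∈ Finset.Icc 1 T, ‖xs k - vs k‖ ^ 2 ≤
      -⟪s T, xs 0 - xstar⟫ - (⟪s T, vs (T + 1) - xs 0⟫ - 1 / 2 * ‖vs (T + 1) - xs 0‖ ^ 2) := by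
    intro T
    induction T with
    | zero => simp [hs0]
    | succ k ih =>
      rw [Finset.sum_Icc_succ_top (by lia), Finset.sum_Icc_succ_top (by lia)]
      have hgrowth := quadratic_growth_of_isMax hXconv (hvsX (k + 1)) (hvmax k) (hvsX (k + 2))
      have hk := hstep k
      have hsplit : xs (k + 1) - xstar =
          (xs (k + 1) - vs (k + 2)) + (vs (k + 2) - xs 0) + (xs 0 - xstar) := by abel
      rw [hsrec k, hsplit]
      simp only [inner_sub_left, inner_add_right, real_inner_smul_left, add_assoc,
        Nat.reduceAdd] at *
      linarith
  intro T hT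
  have hTpos : (0 : ℝ) < T := by exact_mod_cast hT
  have hW : 0 < ∑ k ∈ Finset.Icc 1 T, lam k :=
    Finset.sum_pos (fun k _ => hlampos k) ⟨1, Finset.mem_Icc.2 ⟨le_rfl, hT⟩⟩
  have hdual : ∑ k ∈ Finset.Icc 1 T, lam k * ⟪F (xs k), xs k - xstar⟫ +
      1 / 8 * ∑ k ∈ Finset.Icc 1 T, ‖xs k - vs k‖ ^ 2 ≤ 1 / 2 * ‖xs 0 - xstar‖ ^ 2 := by
    have h1 := hlyap T
    have h2 := hvmax T xstar hxstarX
    rw [← neg_sub (xs 0) xstar, inner_neg_right, norm_neg] at h2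
    linarith
  have hmono : μ * ∑ k ∈ Finset.Icc 1 T, lam k * ‖xs k - xstar‖ ^ 2 ≤
      ∑ k ∈ Finset.Icc 1 T, lam k * ⟪F (xs k), xs k - xstar⟫ := by
    rw [Finset.mul_sum]
    refine Finset.sum_le_sum fun k _ => ?_
    have h1 := hstrong _ (hxsX k) _ hxstarX
    rw [inner_sub_left] at h1
    have h2 := hstrongsol _ (hxsX k)
    rw [mul_left_comm]
    exact mul_le_mul_of_nonneg_left (by linarith) (hlampos k).le
  have havg := mul_le_mul_of_nonneg_left (sum_mul_norm_average_sub_sq_le (Finset.Icc 1 T) xs xstar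
    (fun k _ => (hlampos k).le) hW) hμ.le
  have hnonneg : 0 ≤ μ * ∑ k ∈ Finset.Icc 1 T, lam k * ‖xs k - xstar‖ ^ 2 :=
    mul_nonneg hμ.le (Finset.sum_nonneg fun k _ => mul_nonneg (hlampos k).le (sq_nonneg _))
  have hr : ∑ k ∈ Finset.Icc 1 T, ‖xs k - vs k‖ ^ 2 ≤ 4 * ‖xs 0 - xstar‖ ^ 2 := by linarith
  have hrnonneg : 0 ≤ ∑ k ∈ Finset.Icc 1 T, ‖xs k - vs k‖ ^ 2 :=
    Finset.sum_nonneg fun k _ => sq_nonneg _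
  have hinv := inv_sum_le_sqrt (S := Finset.Icc 1 T) (T := (T : ℝ)) (L := L) (δ := δ)
    (r := fun k => ‖xs k - vs k‖) (by simp) hTpos (fun k _ => hlampos k)
    (fun k hk => by
      obtain ⟨j, rfl⟩ := Nat.exists_eq_add_of_le' (Finset.mem_Icc.1 hk).1
      exact (hlam j).1) hr
  refine le_trans ?_ (mul_le_mul_of_nonneg_left hinv (by positivity))
  rw [← div_eq_mul_inv, le_div_iff₀ hW]
  linarith
end

section
/- Let X, F, J, δ, L and the VIJI iterates (x_k, v_k, s_k, λ_k) with η = 10 be as in the context, with F μ-strongly monotone on X, strong solution x* ∈ X, and ∥x_0 − x*∥ ≤ R. If the number of iterations satisfies T ≥ max{ 2^{14/3} L^{2/3} R^{2/3} / μ^{2/3}, 2^7 δ / μ }, then the weighted average x̃_T = (∑_{k=1}^T λ_k x_k)/(∑_{k=1}^T λ_k) satisfies ∥x̃_T − x*∥ ≤ R/2. -/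
open scoped RealInnerProductSpace

section

variable {E : Type*} [NormedAddCommGroup E] [InnerProductSpace ℝ E]

/-- Second-order Taylor bound for a map whose derivative is `L`-Lipschitz on a convex set. -/
lemma norm_taylor_remainder_le {G : Type*} [NormedAddCommGroup G] [NormedSpace ℝ G]
    {X : Set G} (hX : Convex ℝ X) {F : G → G} {F' : G → G →L[ℝ] G}
    (hF' : ∀ x, HasFDerivAt F (F' x) x) {L : ℝ}
    (hsmooth : ∀ x ∈ X, ∀ y ∈ X, ‖F' x - F' y‖ ≤ L * ‖x - y‖)
    {v x : G} (hv : v ∈ X) (hx : x ∈ X) :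
    ‖F x - F v - F' v (x - v)‖ ≤ L / 2 * ‖x - v‖ ^ 2 := by
  set h := x - v with hh
  have hseg : ∀ t ∈ Set.Icc (0 : ℝ) 1, v + t • h ∈ X := fun t ht =>
    hX.add_smul_sub_mem hv hx ht
  have hder : ∀ t : ℝ, HasDerivAt (fun t : ℝ => F (v + t • h) - F v - t • F' v h)
      (F' (v + t • h) h - F' v h) t := by
    intro t
    have h1 : HasDerivAt (fun t : ℝ => v + t • h) h t := by
      simpa using ((hasDerivAt_id t).smul_const h).const_add v
    have h2 : HasDerivAt (fun t : ℝ => t • F' v h) (F' v h) t := by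
      simpa using (hasDerivAt_id t).smul_const (F' v h)
    exact (((hF' (v + t • h)).comp_hasDerivAt t h1).sub_const (F v)).sub h2
  have hB : ∀ t : ℝ, HasDerivAt (fun t : ℝ => L / 2 * ‖h‖ ^ 2 * t ^ 2)
      (L * ‖h‖ ^ 2 * t) t := by
    intro t
    exact ((hasDerivAt_pow 2 t).const_mul (L / 2 * ‖h‖ ^ 2)).congr_deriv (by push_cast; ring)
  have key := image_norm_le_of_norm_deriv_right_le_deriv_boundary
    (a := (0 : ℝ)) (b := 1)
    (fun t _ => (hder t).continuousAt.continuousWithinAt)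
    (fun t _ => (hder t).hasDerivWithinAt) (B := fun t : ℝ => L / 2 * ‖h‖ ^ 2 * t ^ 2)
    (by simp) hB
    (fun t ht => by
      have h1 := hsmooth _ (hseg t ⟨ht.1, ht.2.le⟩) v hv
      have h2 : ‖v + t • h - v‖ = t * ‖h‖ := by
        rw [add_sub_cancel_left, norm_smul, Real.norm_of_nonneg ht.1]
      rw [h2] at h1
      calc ‖F' (v + t • h) h - F' v h‖ = ‖(F' (v + t • h) - F' v) h‖ := by simp
        _ ≤ ‖F' (v + t • h) - F' v‖ * ‖h‖ := ContinuousLinearMap.le_opNorm _ _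
        _ ≤ L * (t * ‖h‖) * ‖h‖ := by gcongr
        _ = L * ‖h‖ ^ 2 * t := by ring)
    (Set.right_mem_Icc.2 zero_le_one)
  simpa [hh] using key

/-- The maximizer over a convex set of a linear function minus half a squared distance satisfies
the quadratic growth inequality. -/
lemma add_half_sq_le_of_isMax {X : Set E} (hX : Convex ℝ X) {s x₀ v : E} (hv : v ∈ X)
    (hmax : ∀ w ∈ X, ⟪s, w - x₀⟫ - 1 / 2 * ‖w - x₀‖ ^ 2 ≤
      ⟪s, v - x₀⟫ - 1 / 2 * ‖v - x₀‖ ^ 2) {w : E} (hw : w ∈ X) :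
    ⟪s, w - x₀⟫ - 1 / 2 * ‖w - x₀‖ ^ 2 + 1 / 2 * ‖w - v‖ ^ 2 ≤
      ⟪s, v - x₀⟫ - 1 / 2 * ‖v - x₀‖ ^ 2 := by
  have expand : ∀ t : ℝ, ⟪s, v + t • (w - v) - x₀⟫ - 1 / 2 * ‖v + t • (w - v) - x₀‖ ^ 2 =
      ⟪s, v - x₀⟫ - 1 / 2 * ‖v - x₀‖ ^ 2 + t * ⟪s - (v - x₀), w - v⟫
        - t ^ 2 / 2 * ‖w - v‖ ^ 2 := by
    intro t
    rw [show v + t • (w - v) - x₀ = (v - x₀) + t • (w - v) by abel, norm_add_sq_real,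
      inner_add_right, inner_smul_right, inner_smul_right, norm_smul, inner_sub_left s, mul_pow,
      Real.norm_eq_abs, sq_abs]
    ring
  have hle : ⟪s - (v - x₀), w - v⟫ ≤ 0 := by
    by_contra! hpos
    set p := ⟪s - (v - x₀), w - v⟫
    set q := ‖w - v‖ ^ 2
    have hq : 0 ≤ q := by positivity
    have ht0 : 0 < p / (p + q) := by positivity
    have ht1 : p / (p + q) ≤ 1 := (div_le_one (by positivity)).2 (by linarith)
    have h1 := hmax _ (hX.add_smul_sub_mem hv hw ⟨ht0.le, ht1⟩)
    rw [expand] at h1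
    have h2 : p / (p + q) * (p - p / (p + q) / 2 * q) ≤ 0 := by linarith
    have h3 : p / (p + q) * q ≤ p := by
      rw [div_mul_eq_mul_div, div_le_iff₀ (by positivity)]
      nlinarith
    have h4 : 0 < p - p / (p + q) / 2 * q := by linarith
    linarith [mul_pos ht0 h4]
  have h1 := expand 1
  simp only [one_smul, add_sub_cancel] at h1
  linarith

/-- One-step estimate for an approximate solution `x` of the inexact model at `v`, compared against
an arbitrary point `w`. -/
lemma step_le {L δ l : ℝ} {f o x v w e : E} (hl : 0 < l)
    (ho : f - o = e - (10 * δ) • (x - v) - (5 * L * ‖x - v‖) • (x - v))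
    (he : ‖e‖ ≤ L / 2 * ‖x - v‖ ^ 2 + δ * ‖x - v‖)
    (hsub : ⟪o, x - w⟫ ≤ L / 2 * ‖x - v‖ ^ 3 + δ * ‖x - v‖ ^ 2)
    (hlow : 1 / 32 ≤ l * (L / 2 * ‖x - v‖ + δ))
    (hup : l * (L / 2 * ‖x - v‖ + δ) ≤ 1 / 22) :
    l * ⟪f, x - w⟫ + 1 / 8 * ‖x - v‖ ^ 2 ≤ 1 / 2 * ‖w - v‖ ^ 2 := by
  have hf : ⟪f, x - w⟫ = ⟪o, x - w⟫ + ⟪e, x - w⟫ - (10 * δ + 5 * L * ‖x - v‖) * ⟪x - v, x - w⟫ := by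
    rw [show f = o + (f - o) by abel, ho]
    simp only [inner_add_left, inner_sub_left, inner_smul_left, RCLike.conj_to_real]
    ring
  have hxw : ‖x - w‖ ≤ ‖x - v‖ + ‖w - v‖ := by
    rw [norm_sub_rev w v]
    exact norm_sub_le_norm_sub_add_norm_sub x v w
  have hin : ‖x - v‖ ^ 2 - ‖x - v‖ * ‖w - v‖ ≤ ⟪x - v, x - w⟫ := by
    rw [show x - w = (x - v) - (w - v) by abel, inner_sub_right, real_inner_self_eq_norm_sq]
    linarith [real_inner_le_norm (x - v) (w - v)]
  set r := ‖x - v‖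
  set m := ‖w - v‖
  have hr : 0 ≤ r := norm_nonneg _
  have hm : 0 ≤ m := norm_nonneg _
  set a := L / 2 * r + δ with ha
  have hapos : 0 < a := pos_of_mul_pos_right (lt_of_lt_of_le (by norm_num) hlow) hl.le
  have he' : ⟪e, x - w⟫ ≤ a * r * (r + m) := by
    have : ‖e‖ ≤ a * r := by rw [ha]; linarith
    exact (real_inner_le_norm _ _).trans (by gcongr)
  have hbound : ⟪f, x - w⟫ ≤ a * (11 * (r * m) - 8 * r ^ 2) := by
    have h1 := mul_le_mul_of_nonneg_left hin (by positivity : 0 ≤ 10 * a)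
    have h2 : 10 * δ + 5 * L * r = 10 * a := by rw [ha]; ring
    have h3 : L / 2 * r ^ 3 + δ * r ^ 2 = a * r ^ 2 := by rw [ha]; ring
    rw [hf, h2]
    rw [h3] at hsub
    linarith
  have h4 : l * ⟪f, x - w⟫ ≤ l * a * (11 * (r * m) - 8 * r ^ 2) := by
    rw [mul_assoc]
    exact mul_le_mul_of_nonneg_left hbound hl.le
  set c := l * a
  nlinarith [sq_nonneg (11 * c * r - m), mul_nonneg (sub_nonneg.2 hup) (sq_nonneg r),
    mul_nonneg (sub_nonneg.2 hlow) (sq_nonneg r),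
    mul_nonneg (mul_nonneg (sub_nonneg.2 hup) (sq_nonneg r)) (by linarith : (0:ℝ) ≤ c)]

/-- Lower bound on a sum of step sizes from a bound on the sum of their approximate inverses. -/
lemma two_le_mul_sum_of_sum_le {ι : Type*} {S : Finset ι} (hS : S.Nonempty) {l a : ι → ℝ} {μ : ℝ}
    (hμ : 0 < μ) (hl : ∀ i ∈ S, 0 < l i) (hla : ∀ i ∈ S, 1 / 32 ≤ l i * a i)
    (hsum : ∑ i ∈ S, a i ≤ μ * (S.card : ℝ) ^ 2 / 64) : 2 ≤ μ * ∑ i ∈ S, l i := by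
  have hT : (0 : ℝ) < S.card := by exact_mod_cast hS.card_pos
  set T : ℝ := (S.card : ℝ) with hTdef
  set b := μ * T / 64 with hb
  have hbpos : 0 < b := by positivity
  have hterm : ∀ i ∈ S, 2 * b - a i ≤ 32 * b ^ 2 * l i := by
    intro i hi
    have hai : 0 < a i :=
      pos_of_mul_pos_right (lt_of_lt_of_le (by norm_num) (hla i hi)) (hl i hi).le
    refine le_of_mul_le_mul_right ?_ hai
    nlinarith [sq_nonneg (b - a i), mul_le_mul_of_nonneg_left (hla i hi) (sq_nonneg b)]
  have h := Finset.sum_le_sum hterm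
  rw [Finset.sum_sub_distrib, Finset.sum_const, nsmul_eq_mul, ← Finset.mul_sum, ← hTdef] at h
  have h2 : b * T ≤ 32 * b ^ 2 * ∑ i ∈ S, l i := by
    have : μ * T ^ 2 / 64 = b * T := by rw [hb]; ring
    linarith
  have h3 : b * T * 2 ≤ b * T * (μ * ∑ i ∈ S, l i) := by
    calc b * T * 2 ≤ 32 * b ^ 2 * (∑ i ∈ S, l i) * 2 := by linarith
      _ = b * T * (μ * ∑ i ∈ S, l i) := by rw [hb]; ring
  exact le_of_mul_le_mul_left h3 (by positivity)

/-- Jensen's inequality for the squared distance from a weighted average to a point. -/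
lemma sum_mul_norm_inv_smul_sub_sq_le {ι : Type*} {S : Finset ι} {l : ι → ℝ} {x : ι → E} {z : E}
    (hl : ∀ i ∈ S, 0 ≤ l i) (hpos : 0 < ∑ i ∈ S, l i) :
    (∑ i ∈ S, l i) * ‖(∑ i ∈ S, l i)⁻¹ • ∑ i ∈ S, l i • x i - z‖ ^ 2 ≤
      ∑ i ∈ S, l i * ‖x i - z‖ ^ 2 := by
  set Λ := ∑ i ∈ S, l i with hΛ
  have h1 : Λ⁻¹ • ∑ i ∈ S, l i • x i - z = Λ⁻¹ • ∑ i ∈ S, l i • (x i - z) := by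
    simp only [smul_sub, Finset.sum_sub_distrib, ← Finset.sum_smul, ← hΛ]
    rw [inv_smul_smul₀ hpos.ne']
  have h2 : ‖∑ i ∈ S, l i • (x i - z)‖ ≤ ∑ i ∈ S, l i * ‖x i - z‖ :=
    norm_sum_le_of_le _ fun i hi => by rw [norm_smul, Real.norm_of_nonneg (hl i hi)]
  have h3 : (∑ i ∈ S, l i * ‖x i - z‖) ^ 2 ≤ Λ * ∑ i ∈ S, l i * ‖x i - z‖ ^ 2 :=
    Finset.sum_sq_le_sum_mul_sum_of_sq_le_mul S hl
      (fun i hi => mul_nonneg (hl i hi) (sq_nonneg _)) (fun i _ => le_of_eq (by ring))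
  have h4 : ‖∑ i ∈ S, l i • (x i - z)‖ ^ 2 ≤ Λ * ∑ i ∈ S, l i * ‖x i - z‖ ^ 2 :=
    (pow_le_pow_left₀ (norm_nonneg _) h2 2).trans h3
  rw [h1, norm_smul, Real.norm_of_nonneg (inv_nonneg.2 hpos.le), mul_pow]
  calc Λ * (Λ⁻¹ ^ 2 * ‖∑ i ∈ S, l i • (x i - z)‖ ^ 2)
      = Λ⁻¹ * ‖∑ i ∈ S, l i • (x i - z)‖ ^ 2 := by field_simp
    _ ≤ Λ⁻¹ * (Λ * ∑ i ∈ S, l i * ‖x i - z‖ ^ 2) := by gcongr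
    _ = _ := inv_mul_cancel_left₀ hpos.ne' _

/-- Potential-function bound for dual extrapolation. -/
lemma dual_extrapolation_sum_le {X : Set E} (hX : Convex ℝ X) {F : E → E} {xs vs s : ℕ → E}
    {lam : ℕ → ℝ} (hvsX : ∀ k, vs k ∈ X) (hs0 : s 0 = 0)
    (hvmax : ∀ k, ∀ w ∈ X,
      ⟪s k, w - xs 0⟫ - 1 / 2 * ‖w - xs 0‖ ^ 2 ≤
        ⟪s k, vs (k + 1) - xs 0⟫ - 1 / 2 * ‖vs (k + 1) - xs 0‖ ^ 2)
    (hsrec : ∀ k, s (k + 1) = s k - lam (k + 1) • F (xs (k + 1)))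
    (hstep : ∀ k, lam (k + 1) * ⟪F (xs (k + 1)), xs (k + 1) - vs (k + 2)⟫
      + 1 / 8 * ‖xs (k + 1) - vs (k + 1)‖ ^ 2 ≤ 1 / 2 * ‖vs (k + 2) - vs (k + 1)‖ ^ 2)
    {z : E} (hz : z ∈ X) (n : ℕ) :
    ∑ k ∈ Finset.range n, (lam (k + 1) * ⟪F (xs (k + 1)), xs (k + 1) - z⟫
      + 1 / 8 * ‖xs (k + 1) - vs (k + 1)‖ ^ 2) ≤ 1 / 2 * ‖z - xs 0‖ ^ 2 := by
  have hind : ∑ k ∈ Finset.range n, (lam (k + 1) * ⟪F (xs (k + 1)), xs (k + 1) - z⟫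
      + 1 / 8 * ‖xs (k + 1) - vs (k + 1)‖ ^ 2) ≤ ⟪s n, z - xs 0⟫
      - (⟪s n, vs (n + 1) - xs 0⟫ - 1 / 2 * ‖vs (n + 1) - xs 0‖ ^ 2) := by
    induction n with
    | zero =>
      simp only [Finset.range_zero, Finset.sum_empty, hs0, inner_zero_left]
      have : 0 ≤ ‖vs (0 + 1) - xs 0‖ ^ 2 := by positivity
      linarith
    | succ n ih =>
      rw [Finset.sum_range_succ]
      have h1 := add_half_sq_le_of_isMax hX (hvsX (n + 1)) (hvmax n) (hvsX (n + 2))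
      have h2 := hstep n
      have h3 : ∀ y, ⟪s (n + 1), y - xs 0⟫ =
          ⟪s n, y - xs 0⟫ - lam (n + 1) * ⟪F (xs (n + 1)), y - xs 0⟫ := by
        intro y
        rw [hsrec, inner_sub_left, real_inner_smul_left]
      have h4 : ∀ y, ⟪F (xs (n + 1)), xs (n + 1) - y⟫ =
          ⟪F (xs (n + 1)), xs (n + 1) - xs 0⟫ - ⟪F (xs (n + 1)), y - xs 0⟫ := by
        intro y
        rw [← inner_sub_right, sub_sub_sub_cancel_right]
      rw [h3, h3, h4]
      rw [h4] at h2
      linarith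
  linarith [hvmax n z hz]

end

/-- per-restart contraction in Theorem on VIJI-Restarted: if `F` is
`μ`-strongly monotone with strong solution `x*`, `‖x_0 − x*‖ ≤ R`, and
`T ≥ max{ 2^{14/3} L^{2/3} R^{2/3} / μ^{2/3}, 2^7 δ / μ }`, then the weighted average
`x̃_T` satisfies `‖x̃_T − x*‖ ≤ R/2`. -/
theorem viji_restart_contraction
    (d : ℕ) (X : Set (EuclideanSpace ℝ (Fin d)))
    (hXconv : Convex ℝ X) (hXclosed : IsClosed X) (hXbdd : Bornology.IsBounded X)
    (F : EuclideanSpace ℝ (Fin d) → EuclideanSpace ℝ (Fin d))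
    (F' : EuclideanSpace ℝ (Fin d) → EuclideanSpace ℝ (Fin d) →L[ℝ] EuclideanSpace ℝ (Fin d))
    (hF' : ∀ x, HasFDerivAt F (F' x) x)
    (L δ : ℝ)
    (hsmooth : ∀ x ∈ X, ∀ y ∈ X, ‖F' x - F' y‖ ≤ L * ‖x - y‖)
    (J : EuclideanSpace ℝ (Fin d) → EuclideanSpace ℝ (Fin d) →L[ℝ] EuclideanSpace ℝ (Fin d))
    (hJ : ∀ v ∈ X, ‖F' v - J v‖ ≤ δ)
    (Ω : EuclideanSpace ℝ (Fin d) → EuclideanSpace ℝ (Fin d) → EuclideanSpace ℝ (Fin d))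
    (hΩ : ∀ v x, Ω v x = F v + J v (x - v) + (10 * δ) • (x - v)
      + (5 * L * ‖x - v‖) • (x - v))
    (xs vs s : ℕ → EuclideanSpace ℝ (Fin d)) (lam : ℕ → ℝ)
    (hxsX : ∀ k, xs k ∈ X) (hvsX : ∀ k, vs k ∈ X)
    (hs0 : s 0 = 0)
    (hlampos : ∀ k, 0 < lam k)
    (hvmax : ∀ k, ∀ w ∈ X,
      ⟪s k, w - xs 0⟫ - 1 / 2 * ‖w - xs 0‖ ^ 2 ≤
        ⟪s k, vs (k + 1) - xs 0⟫ - 1 / 2 * ‖vs (k + 1) - xs 0‖ ^ 2)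
    (hsub : ∀ k, ∀ w ∈ X,
      ⟪Ω (vs (k + 1)) (xs (k + 1)), xs (k + 1) - w⟫ ≤
        L / 2 * ‖xs (k + 1) - vs (k + 1)‖ ^ 3 + δ * ‖xs (k + 1) - vs (k + 1)‖ ^ 2)
    (hlam : ∀ k, 1 / 32 ≤ lam (k + 1) * (L / 2 * ‖xs (k + 1) - vs (k + 1)‖ + δ) ∧
      lam (k + 1) * (L / 2 * ‖xs (k + 1) - vs (k + 1)‖ + δ) ≤ 1 / 22)
    (hsrec : ∀ k, s (k + 1) = s k - lam (k + 1) • F (xs (k + 1)))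
    (μ : ℝ) (hμ : 0 < μ)
    (hstrong : ∀ x ∈ X, ∀ y ∈ X, μ * ‖x - y‖ ^ 2 ≤ ⟪F x - F y, x - y⟫)
    (xstar : EuclideanSpace ℝ (Fin d)) (hxstarX : xstar ∈ X)
    (hstrongsol : ∀ x ∈ X, 0 ≤ ⟪F xstar, x - xstar⟫)
    (R : ℝ) (hR : ‖xs 0 - xstar‖ ≤ R)
    (T : ℕ) (hT1 : 1 ≤ T)
    (hT : max ((2 : ℝ) ^ ((14 : ℝ) / 3) * L ^ ((2 : ℝ) / 3) * R ^ ((2 : ℝ) / 3)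
        / μ ^ ((2 : ℝ) / 3)) (2 ^ 7 * δ / μ) ≤ (T : ℝ)) :
    ‖((∑ k ∈ Finset.Icc 1 T, lam k)⁻¹ •
        ∑ k ∈ Finset.Icc 1 T, lam k • xs k) - xstar‖ ≤ R / 2 := by
  have hT0 : (0 : ℝ) < T := by exact_mod_cast hT1
  have hR0 : 0 ≤ R := (norm_nonneg _).trans hR
  have hΛ : 0 < ∑ k ∈ Finset.Icc 1 T, lam k :=
    Finset.sum_pos (fun k _ => hlampos k) (Finset.nonempty_Icc.2 hT1)
  have hjensen := sum_mul_norm_inv_smul_sub_sq_le (S := Finset.Icc 1 T) (x := xs) (z := xstar)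
    (fun k _ => (hlampos k).le) hΛ
  rcases lt_or_ge L 0 with hL | hL
  · have hsingle : ∀ x ∈ X, x = xstar := fun x hx => by
      have h1 := (norm_nonneg _).trans (hsmooth x hx xstar hxstarX)
      have h2 : ‖x - xstar‖ ≤ 0 := by
        by_contra! h
        linarith [mul_neg_of_neg_of_pos hL h]
      exact sub_eq_zero.1 (norm_le_zero_iff.1 h2)
    have hxs : ∀ k, xs k = xstar := fun k => hsingle _ (hxsX k)
    simp only [hxs, ← Finset.sum_smul]
    rw [inv_smul_smul₀ hΛ.ne', sub_self, norm_zero]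
    positivity
  have hstep : ∀ k, lam (k + 1) * ⟪F (xs (k + 1)), xs (k + 1) - vs (k + 2)⟫
      + 1 / 8 * ‖xs (k + 1) - vs (k + 1)‖ ^ 2 ≤ 1 / 2 * ‖vs (k + 2) - vs (k + 1)‖ ^ 2 := by
    intro k
    set x := xs (k + 1)
    set v := vs (k + 1)
    have hvX : v ∈ X := hvsX _
    refine step_le (e := (F x - F v - F' v (x - v)) + (F' v - J v) (x - v)) (hlampos _) ?_ ?_
      (hsub k _ (hvsX _)) (hlam k).1 (hlam k).2
    · rw [hΩ, sub_apply]
      abel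
    · refine norm_add_le_of_le (norm_taylor_remainder_le hXconv hF' hsmooth hvX (hxsX _)) ?_
      exact ((F' v - J v).le_opNorm _).trans
        (mul_le_mul_of_nonneg_right (hJ v hvX) (norm_nonneg _))
  have hpot := dual_extrapolation_sum_le hXconv hvsX hs0 hvmax hsrec hstep hxstarX T
  rw [norm_sub_rev] at hpot
  have hRsq : ‖xs 0 - xstar‖ ^ 2 ≤ R ^ 2 := pow_le_pow_left₀ (norm_nonneg _) hR 2
  have hmono : ∀ k, μ * ‖xs k - xstar‖ ^ 2 ≤ ⟪F (xs k), xs k - xstar⟫ := by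
    intro k
    have h1 := hstrong _ (hxsX k) _ hxstarX
    rw [inner_sub_left] at h1
    linarith [hstrongsol _ (hxsX k)]
  have hdist : μ * ∑ k ∈ Finset.Icc 1 T, lam k * ‖xs k - xstar‖ ^ 2
      + 1 / 8 * ∑ k ∈ Finset.Icc 1 T, ‖xs k - vs k‖ ^ 2 ≤ 1 / 2 * R ^ 2 := by
    rw [Finset.range_eq_Ico, Finset.sum_Ico_add' (fun k => lam k * ⟪F (xs k), xs k - xstar⟫
      + 1 / 8 * ‖xs k - vs k‖ ^ 2), zero_add, Finset.Ico_add_one_right_eq_Icc] at hpot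
    rw [Finset.mul_sum, Finset.mul_sum, ← Finset.sum_add_distrib]
    refine (Finset.sum_le_sum fun k _ => ?_).trans (hpot.trans (by linarith))
    linarith [mul_le_mul_of_nonneg_left (hmono k) (hlampos k).le]
  have hD0 : 0 ≤ ∑ k ∈ Finset.Icc 1 T, lam k * ‖xs k - xstar‖ ^ 2 :=
    Finset.sum_nonneg fun k _ => mul_nonneg (hlampos k).le (sq_nonneg _)
  have hr : ∑ k ∈ Finset.Icc 1 T, ‖xs k - vs k‖ ^ 2 ≤ 4 * R ^ 2 := by
    linarith [mul_nonneg hμ.le hD0]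
  have hrsum : (∑ k ∈ Finset.Icc 1 T, ‖xs k - vs k‖) ^ 2 ≤ T * (4 * R ^ 2) := by
    have h1 := sq_sum_le_card_mul_sum_sq (s := Finset.Icc 1 T) (f := fun k => ‖xs k - vs k‖)
    rw [Nat.card_Icc, Nat.add_sub_cancel] at h1
    exact h1.trans (by gcongr)
  have hTδ : 2 ^ 7 * δ ≤ μ * T := by
    have h1 := (le_max_right _ _).trans hT
    rw [div_le_iff₀ hμ] at h1
    linarith
  have hTL : 2 ^ 14 * L ^ 2 * R ^ 2 ≤ μ ^ 2 * (T : ℝ) ^ 3 := by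
    have h1 := (le_max_left _ _).trans hT
    have cube : ∀ {y : ℝ}, 0 ≤ y → ∀ n : ℕ, (y ^ ((n : ℝ) / 3)) ^ 3 = y ^ n := by
      intro y hy n
      rw [← Real.rpow_mul_natCast hy, Nat.cast_ofNat, div_mul_cancel₀ _ (by norm_num),
        Real.rpow_natCast]
    have h2 := pow_le_pow_left₀ (by positivity) h1 3
    have c14 := cube (zero_le_two : (0 : ℝ) ≤ 2) 14
    have cL := cube hL 2
    have cR := cube hR0 2
    have cμ := cube hμ.le 2
    rw [Nat.cast_ofNat] at c14 cL cR cμ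
    rw [div_pow, mul_pow, mul_pow, c14, cL, cR, cμ, div_le_iff₀ (by positivity)] at h2
    linarith
  have hLsum : L / 2 * ∑ k ∈ Finset.Icc 1 T, ‖xs k - vs k‖ ≤ μ * (T : ℝ) ^ 2 / 128 := by
    refine le_of_abs_le (abs_le_of_sq_le_sq ?_ (by positivity))
    rw [mul_pow]
    have h1 := mul_le_mul_of_nonneg_left hrsum (sq_nonneg (L / 2))
    have h2 := mul_le_mul_of_nonneg_left hTL hT0.le
    linarith
  have hμΛ : 2 ≤ μ * ∑ k ∈ Finset.Icc 1 T, lam k := by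
    refine two_le_mul_sum_of_sum_le (a := fun k => L / 2 * ‖xs k - vs k‖ + δ)
      (Finset.nonempty_Icc.2 hT1) hμ (fun k _ => hlampos k) ?_ ?_
    · intro k hk
      obtain ⟨j, rfl⟩ := Nat.exists_eq_add_of_le' (Finset.mem_Icc.1 hk).1
      exact (hlam j).1
    · rw [Finset.sum_add_distrib, ← Finset.mul_sum, Finset.sum_const, Nat.card_Icc,
        Nat.add_sub_cancel, nsmul_eq_mul]
      have h1 := mul_le_mul_of_nonneg_left hTδ hT0.le
      linarith
  set N := ‖((∑ k ∈ Finset.Icc 1 T, lam k)⁻¹ • ∑ k ∈ Finset.Icc 1 T, lam k • xs k) - xstar‖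
  refine le_of_abs_le (abs_le_of_sq_le_sq ?_ (by positivity))
  have h1 := mul_le_mul_of_nonneg_left hjensen hμ.le
  have h2 := mul_le_mul_of_nonneg_right hμΛ (sq_nonneg N)
  have h3 : 0 ≤ ∑ k ∈ Finset.Icc 1 T, ‖xs k - vs k‖ ^ 2 :=
    Finset.sum_nonneg fun k _ => sq_nonneg _
  linarith
end
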